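/- Let μ be a finite positive Borel measure on ℝ and let U = ⋃_{m∈ℕ} (a_m, b_m) be a disjoint union of nonempty bounded open intervals with real endpoints a_m < b_m. Let ∂U denote the topological boundary of U, let ν be the restriction of μ to ∂U and σ the restriction of μ to ℝ \ ∂U. For a finite positive Borel measure τ on ℝ, say a measurable g : ℝ → ℝ represents τ if for every nonnegative bounded continuous f : ℝ → ℝ, lim_{θ→∞} (πθ/2)·∫_ℝ f(t)·1_{{t : |g(t)| ≥ θ}}(t) dt = ∫_ℝ f dτ_s, where τ_s is the singular part of τ with respect to Lebesgue measure. Suppose h, h₁, h₂ : ℝ → ℝ are measurable with h(t) = h₁(t) + h₂(t) for all t ∉ ∂U, there is C > 0 with |h₂(t)| ≤ C/dist(t, ∂U) for all t ∉ ∂U, h represents μ, and h₁ represents σ. Let (f_l)_{l∈ℕ} be continuous functions with 0 ≤ f_l ≤ f_{l+1} ≤ 1, f_l → 1_U pointwise, and the support of f_l contained in [−l, l] ∩ ⋃_{m=1}^{l} [a_m + 1/√l, b_m − 1/√l]. Then lim_{l→∞} (πl/2)·∫_ℝ f_l(t)·1_{{t : |h(t)| ≥ l}}(t) dt = μ_s(U),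 where μ_s is the singular part of μ with respect to Lebesgue measure. -/

import Mathlib

open MeasureTheory Filter Topology

noncomputable section

/-- A measurable function `g` "represents" a finite measure `τ` if the level-set averages
`(πθ/2)·∫ f·1_{|g| ≥ θ}` recover `∫ f dτ_s` for all nonnegative bounded continuous `f`,
where `τ_s` is the singular part of `τ` with respect to Lebesgue measure. -/
def Represents (g : ℝ → ℝ) (τ : Measure ℝ) : Prop :=
  ∀ f : ℝ → ℝ, Continuous f → (∀ t, 0 ≤ f t) → (∃ M : ℝ, ∀ t, f t ≤ M) →
    Tendsto (fun θ : ℝ => Real.pi * θ / 2 * ∫ t in {t : ℝ | θ ≤ |g t|}, f t)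
      atTop (𝓝 (∫ t, f t ∂(τ.singularPart volume)))

/-- A measurable set of infinite Lebesgue measure carries at least half of the mass of some
continuous probability density bounded by `1`. -/
lemma exists_continuous_density_of_volume_eq_top {s : Set ℝ} (hs : MeasurableSet s)
    (hvol : volume s = ⊤) :
    ∃ φ : ℝ → ℝ, Continuous φ ∧ (∀ t, 0 ≤ φ t) ∧ (∀ t, φ t ≤ 1) ∧ Integrable φ ∧
      ∫ t, φ t = 1 ∧ 1 / 2 ≤ ∫ t in s, φ t := by
  obtain ⟨K, hKs, hK, hK1⟩ := hs.exists_lt_isCompact (μ := volume) (r := 1) (by simp [hvol])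
  obtain ⟨V, hKV, hV, hVK⟩ := hK.exists_isOpen_lt_add (μ := volume) (ε := 1) one_ne_zero
  have hKtop : volume K ≠ ⊤ := hK.measure_lt_top.ne
  have hVtop : volume V ≠ ⊤ := (hVK.trans (by simp [hK.measure_lt_top])).ne
  have hK1' : 1 < volume.real K := by
    simpa [Measure.real] using (ENNReal.toReal_lt_toReal (by simp) hKtop).2 hK1
  have hVK' : volume.real V ≤ volume.real K + 1 := by
    have := (ENNReal.toReal_le_toReal hVtop (by simp [hKtop])).2 hVK.le
    rwa [ENNReal.toReal_add hKtop (by simp), ENNReal.toReal_one] at this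
  obtain ⟨ψ, ψK, ψV, ψc, ψr⟩ := exists_continuous_one_zero_of_isCompact hK hV.isClosed_compl
    (Set.disjoint_compl_right_iff_subset.2 hKV)
  have hint : Integrable ψ := ψ.continuous.integrable_of_hasCompactSupport ψc
  have hupper : ∫ t, ψ t ≤ volume.real V := by
    rw [← integral_indicator_one hV.measurableSet]
    refine integral_mono hint ((integrable_indicator_iff hV.measurableSet).2
      (integrableOn_const hVtop)) fun t => ?_
    by_cases ht : t ∈ V
    · simpa [ht] using (ψr t).2
    · simpa [ht] using (ψV ht).le
  have hlower : volume.real K ≤ ∫ t in s, ψ t := by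
    rw [← integral_indicator_one hK.measurableSet, ← integral_indicator hs]
    refine integral_mono ((integrable_indicator_iff hK.measurableSet).2
      (integrableOn_const hKtop)) (hint.indicator hs) fun t => ?_
    by_cases ht : t ∈ K
    · simpa [ht, hKs ht] using (ψK ht).ge
    · simpa [ht] using Set.indicator_nonneg (fun t _ => (ψr t).1) t
  have hle : ∫ t in s, ψ t ≤ ∫ t, ψ t :=
    setIntegral_le_integral hint (ae_of_all _ fun t => (ψr t).1)
  set I := ∫ t, ψ t with hI
  have hI1 : 1 < I := by linarith
  refine ⟨fun t => ψ t / I, by fun_prop, fun t => div_nonneg (ψr t).1 (by linarith),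
    fun t => ?_, hint.div_const I, ?_, ?_⟩
  · rw [div_le_one (by linarith)]
    linarith [(ψr t).2]
  · rw [integral_div, div_self (by linarith)]
  · rw [integral_div, le_div_iff₀ (by linarith)]
    linarith

/-- If `g` represents some measure, its high level sets have finite Lebesgue measure. -/
lemma Represents.exists_volume_lt_top {g : ℝ → ℝ} {τ : Measure ℝ} (hg : Measurable g)
    (hrep : Represents g τ) : ∃ θ₀ : ℝ, ∀ θ, θ₀ ≤ θ → volume {t : ℝ | θ ≤ |g t|} < ⊤ := by
  by_contra! hcon
  have hmeas (θ : ℝ) : MeasurableSet {t : ℝ | θ ≤ |g t|} := measurableSet_le measurable_const hg.abs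
  have htop (θ : ℝ) : volume {t : ℝ | θ ≤ |g t|} = ⊤ := by
    obtain ⟨θ', hθ, h'⟩ := hcon θ
    exact top_le_iff.1 (h'.trans (measure_mono fun t ht => hθ.trans ht))
  choose φ φc φ0 φ1 φint φI φE using fun k : ℕ =>
    exists_continuous_density_of_volume_eq_top (hmeas (4 ^ k)) (htop (4 ^ k))
  have hgeom : Summable fun k : ℕ => (1 / 2 : ℝ) ^ k := summable_geometric_two
  have hF0 (k : ℕ) (t : ℝ) : 0 ≤ (1 / 2 : ℝ) ^ k * φ k t := mul_nonneg (by positivity) (φ0 k t)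
  have hF1 (k : ℕ) (t : ℝ) : (1 / 2 : ℝ) ^ k * φ k t ≤ (1 / 2) ^ k :=
    mul_le_of_le_one_right (by positivity) (φ1 k t)
  have hFnorm (k : ℕ) (t : ℝ) : ‖(1 / 2 : ℝ) ^ k * φ k t‖ ≤ (1 / 2) ^ k := by
    rw [Real.norm_of_nonneg (hF0 k t)]
    exact hF1 k t
  have hlim := hrep (fun t => ∑' k : ℕ, (1 / 2 : ℝ) ^ k * φ k t)
    (continuous_tsum (fun k => (φc k).const_mul _) hgeom hFnorm)
    (fun t => tsum_nonneg fun k => hF0 k t)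
    ⟨∑' k : ℕ, (1 / 2 : ℝ) ^ k, fun t =>
      (Summable.of_nonneg_of_le (hF0 · t) (hF1 · t) hgeom).tsum_le_tsum (hF1 · t) hgeom⟩
  have hbound (k : ℕ) : (2 : ℝ) ^ k / 2 ≤ Real.pi * 4 ^ k / 2 *
      ∫ t in {t : ℝ | (4 : ℝ) ^ k ≤ |g t|}, ∑' k : ℕ, (1 / 2 : ℝ) ^ k * φ k t := by
    have hsum := hasSum_integral_of_summable_integral_norm
      (μ := volume.restrict {t : ℝ | (4 : ℝ) ^ k ≤ |g t|})
      (F := fun (j : ℕ) t => (1 / 2 : ℝ) ^ j * φ j t)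
      (fun j => ((φint j).const_mul _).restrict)
      (.of_nonneg_of_le (fun j => integral_nonneg fun t => norm_nonneg _) (fun j => by
        simp_rw [Real.norm_of_nonneg (hF0 j _)]
        refine (setIntegral_le_integral ((φint j).const_mul _) (ae_of_all _ (hF0 j))).trans ?_
        rw [integral_const_mul, φI, mul_one]) hgeom)
    have hk := le_hasSum hsum k fun j _ => integral_nonneg (hF0 j)
    rw [integral_const_mul] at hk
    have h1 : (1 / 2 : ℝ) ^ k * (1 / 2) ≤
        (1 / 2 : ℝ) ^ k * ∫ t in {t : ℝ | (4 : ℝ) ^ k ≤ |g t|}, φ k t :=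
      mul_le_mul_of_nonneg_left (φE k) (by positivity)
    have h4 : (4 : ℝ) ^ k * ((1 / 2) ^ k * (1 / 2)) = 2 ^ k / 2 := by
      rw [← mul_assoc, ← mul_pow]
      norm_num
      ring
    calc (2 : ℝ) ^ k / 2 = 4 ^ k * ((1 / 2) ^ k * (1 / 2)) := h4.symm
      _ ≤ Real.pi * 4 ^ k / 2 * ((1 / 2) ^ k * (1 / 2)) := by
        gcongr
        nlinarith [Real.pi_gt_three, pow_pos (four_pos : (0 : ℝ) < 4) k]
      _ ≤ _ := by
        gcongr
        exact h1.trans hk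
  have htend := hlim.comp (tendsto_pow_atTop_atTop_of_one_lt (by norm_num : (1 : ℝ) < 4))
  exact not_tendsto_nhds_of_tendsto_atTop (tendsto_atTop_mono hbound
    ((tendsto_pow_atTop_atTop_of_one_lt one_lt_two).atTop_div_const two_pos)) _ htend

lemma sub_mul_sqrt_tendsto_atTop (C : ℝ) :
    Tendsto (fun l : ℕ => (l : ℝ) - C * Real.sqrt l) atTop atTop := by
  have hs : Tendsto (fun l : ℕ => Real.sqrt l) atTop atTop :=
    Real.tendsto_sqrt_atTop.comp tendsto_natCast_atTop_atTop
  refine (hs.atTop_mul_atTop₀ (tendsto_atTop_add_const_right _ (-C) hs)).congr fun l => ?_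
  rw [mul_add, Real.mul_self_sqrt (Nat.cast_nonneg l)]
  ring

lemma div_sub_mul_sqrt_tendsto_one (C : ℝ) :
    Tendsto (fun l : ℕ => (l : ℝ) / (l - C * Real.sqrt l)) atTop (𝓝 1) := by
  have hs : Tendsto (fun l : ℕ => Real.sqrt l) atTop atTop :=
    Real.tendsto_sqrt_atTop.comp tendsto_natCast_atTop_atTop
  have h1 : Tendsto (fun l : ℕ => (1 - C / Real.sqrt l)⁻¹) atTop (𝓝 1) := by
    have := ((hs.const_div_atTop C).const_sub 1).inv₀ (by norm_num)
    simpa using this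
  refine h1.congr' ?_
  filter_upwards [eventually_ge_atTop 1] with l hl
  have hl0 : (0 : ℝ) < l := by exact_mod_cast hl
  have hsq : Real.sqrt l * Real.sqrt l = l := Real.mul_self_sqrt hl0.le
  have hspos : 0 < Real.sqrt l := Real.sqrt_pos.2 hl0
  have : (l : ℝ) - C * Real.sqrt l = l * (1 - C / Real.sqrt l) := by
    field_simp
    linear_combination -C * hsq
  rw [this, ← div_div, div_self hl0.ne', one_div]

lemma le_infDist_frontier_iUnion_Ioo {a b : ℕ → ℝ} {d t : ℝ} {m : ℕ}
    (ht : t ∈ Set.Icc (a m + d) (b m - d))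
    (hne : (frontier (⋃ m, Set.Ioo (a m) (b m))).Nonempty) :
    d ≤ Metric.infDist t (frontier (⋃ m, Set.Ioo (a m) (b m))) := by
  refine (Metric.le_infDist hne).2 fun s hs => ?_
  have hopen : IsOpen (⋃ m, Set.Ioo (a m) (b m)) := isOpen_iUnion fun _ => isOpen_Ioo
  have hsU : s ∉ Set.Ioo (a m) (b m) := fun h' =>
    (hopen.frontier_eq ▸ hs).2 (Set.mem_iUnion_of_mem m h')
  rw [Real.dist_eq, le_abs']
  by_cases hsa : a m < s
  · have : b m ≤ s := not_lt.1 fun hsb => hsU ⟨hsa, hsb⟩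
    left; linarith [ht.2]
  · right; linarith [ht.1]

theorem stmt18 (μ : Measure ℝ) [IsFiniteMeasure μ]
    (a b : ℕ → ℝ) (hab : ∀ m, a m < b m)
    (hdisj : Pairwise (Function.onFun Disjoint fun m => Set.Ioo (a m) (b m)))
    (h h₁ h₂ : ℝ → ℝ)
    (hm : Measurable h) (hm₁ : Measurable h₁) (hm₂ : Measurable h₂)
    (hsum : ∀ t ∉ frontier (⋃ m, Set.Ioo (a m) (b m)), h t = h₁ t + h₂ t)
    (hC : ∃ C : ℝ, 0 < C ∧ ∀ t ∉ frontier (⋃ m, Set.Ioo (a m) (b m)),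
      |h₂ t| ≤ C / Metric.infDist t (frontier (⋃ m, Set.Ioo (a m) (b m))))
    (hrep : Represents h μ)
    (hrep₁ : Represents h₁ (μ.restrict (frontier (⋃ m, Set.Ioo (a m) (b m)))ᶜ))
    (f : ℕ → ℝ → ℝ) (hfc : ∀ l, Continuous (f l))
    (hf0 : ∀ l t, 0 ≤ f l t) (hfmono : ∀ l t, f l t ≤ f (l + 1) t)
    (hf1 : ∀ l t, f l t ≤ 1)
    (hflim : ∀ t : ℝ,
      Tendsto (fun l => f l t) atTop
        (𝓝 (Set.indicator (⋃ m, Set.Ioo (a m) (b m)) (fun _ => (1 : ℝ)) t)))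
    (hfsupp : ∀ l : ℕ, 1 ≤ l → Function.support (f l) ⊆
      Set.Icc (-(l : ℝ)) l ∩
        ⋃ m ∈ Finset.range l,
          Set.Icc (a m + 1 / Real.sqrt l) (b m - 1 / Real.sqrt l)) :
    Tendsto
      (fun l : ℕ => Real.pi * l / 2 * ∫ t in {t : ℝ | (l : ℝ) ≤ |h t|}, f l t)
      atTop
      (𝓝 ((μ.singularPart volume (⋃ m, Set.Ioo (a m) (b m))).toReal)) := by
  obtain ⟨C, hC0, hC⟩ := hC
  set U := ⋃ m, Set.Ioo (a m) (b m) with hU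
  have hUo : IsOpen U := isOpen_iUnion fun _ => isOpen_Ioo
  have hmeas (θ : ℝ) : MeasurableSet {t : ℝ | θ ≤ |h t|} := measurableSet_le measurable_const hm.abs
  have hmeas₁ (θ : ℝ) : MeasurableSet {t : ℝ | θ ≤ |h₁ t|} :=
    measurableSet_le measurable_const hm₁.abs
  have hmono : ∀ t, Monotone fun l => f l t := fun t => monotone_nat_of_le_succ fun l => hfmono l t
  have hfint (l : ℕ) (hl : 1 ≤ l) : Integrable (f l) :=
    (hfc l).integrable_of_hasCompactSupport <| HasCompactSupport.of_support_subset_isCompact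
      isCompact_Icc ((hfsupp l hl).trans Set.inter_subset_left)
  have hmass : Tendsto (fun l => ∫ t, f l t ∂(μ.singularPart volume)) atTop
      (𝓝 ((μ.singularPart volume U).toReal)) := by
    have := tendsto_integral_of_dominated_convergence (μ := μ.singularPart volume)
      (F := f) (f := U.indicator fun _ => (1 : ℝ)) (fun _ => 1)
      (fun l => (hfc l).aestronglyMeasurable) (integrable_const 1)
      (fun l => ae_of_all _ fun t => by rw [Real.norm_of_nonneg (hf0 l t)]; exact hf1 l t)
      (ae_of_all _ hflim)
    rwa [integral_indicator_const _ hUo.measurableSet, smul_eq_mul, mul_one] at this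
  refine tendsto_order.2 ⟨fun x hx => ?_, fun x hx => ?_⟩
  · obtain ⟨k, hkx, hk1⟩ := ((hmass.eventually_const_lt hx).and (eventually_ge_atTop 1)).exists
    have hk := (hrep (f k) (hfc k) (hf0 k) ⟨1, hf1 k⟩).comp tendsto_natCast_atTop_atTop
    filter_upwards [hk.eventually_const_lt hkx, eventually_ge_atTop k] with l hl hkl
    refine hl.trans_le (mul_le_mul_of_nonneg_left ?_ (by positivity))
    exact integral_mono (hfint k hk1).restrict (hfint l (hk1.trans hkl)).restrict
      fun t => hmono t hkl
  · have hσ : ((μ.restrict (frontier U)ᶜ).singularPart volume).real (closure U) =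
        (μ.singularPart volume U).toReal := by
      rw [Measure.singularPart_restrict _ _ isClosed_frontier.measurableSet.compl, Measure.real,
        Measure.restrict_apply isClosed_closure.measurableSet, hUo.frontier_eq]
      congr 2
      ext t
      have : t ∈ U → t ∈ closure U := fun ht => subset_closure ht
      simp only [Set.mem_inter_iff, Set.mem_compl_iff, Set.mem_sdiff]
      tauto
    obtain ⟨g, gc, g0, g1, gU, gx⟩ : ∃ g : ℝ → ℝ, Continuous g ∧ (∀ t, 0 ≤ g t) ∧
        (∀ t, g t ≤ 1) ∧ (∀ t ∈ U, 1 ≤ g t) ∧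
        ∫ t, g t ∂((μ.restrict (frontier U)ᶜ).singularPart volume) < x := by
      have hδ := tendsto_integral_thickenedIndicator_of_isClosed
        ((μ.restrict (frontier U)ᶜ).singularPart volume) (isClosed_closure (s := U))
        (δs := fun n => 1 / ((n : ℝ) + 1)) (fun n => by positivity)
        tendsto_one_div_add_atTop_nhds_zero_nat
      rw [hσ] at hδ
      obtain ⟨n, hn⟩ := (hδ.eventually_lt_const hx).exists
      have hpos : 0 < 1 / ((n : ℝ) + 1) := by positivity
      refine ⟨fun t => thickenedIndicator hpos (closure U) t, by fun_prop, fun t => by positivity,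
        fun t => by exact_mod_cast thickenedIndicator_le_one hpos _ t, fun t ht => ?_, hn⟩
      exact_mod_cast (thickenedIndicator_one hpos _ (subset_closure ht)).ge
    obtain ⟨θ₀, hθ₀⟩ := hrep₁.exists_volume_lt_top hm₁
    have hθ := sub_mul_sqrt_tendsto_atTop C
    have hlim := (div_sub_mul_sqrt_tendsto_one C).mul ((hrep₁ g gc g0 ⟨1, g1⟩).comp hθ)
    rw [one_mul] at hlim
    filter_upwards [hlim.eventually_lt_const gx, hθ.eventually_gt_atTop 0,
      hθ.eventually_ge_atTop θ₀, eventually_ge_atTop 1] with l hl hlpos hlθ hl1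
    refine lt_of_le_of_lt ?_ hl
    simp only [Function.comp_apply]
    set θ := (l : ℝ) - C * Real.sqrt l with hθdef
    have hscale (J : ℝ) : (l : ℝ) / θ * (Real.pi * θ / 2 * J) = Real.pi * l / 2 * J := by
      field_simp
    rw [hscale]
    refine mul_le_mul_of_nonneg_left ?_ (by positivity)
    rw [← integral_indicator (hmeas l), ← integral_indicator (hmeas₁ θ)]
    have hgint : IntegrableOn g {t : ℝ | θ ≤ |h₁ t|} :=
      Measure.integrableOn_of_bounded (M := 1) (hθ₀ θ hlθ).ne gc.aestronglyMeasurable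
        (ae_of_all _ fun t => by rw [Real.norm_of_nonneg (g0 t)]; exact g1 t)
    refine integral_mono_of_nonneg (ae_of_all _ fun t => Set.indicator_nonneg (fun t _ => hf0 l t) t)
      ((integrable_indicator_iff (hmeas₁ θ)).2 hgint) (ae_of_all _ fun t => ?_)
    refine Set.indicator_le' (fun t ht => ?_) (fun t _ =>
      Set.indicator_nonneg (fun t _ => g0 t) t) t
    by_cases hft : f l t = 0
    · rw [hft]
      exact Set.indicator_nonneg (fun t _ => g0 t) t
    have hsq : 0 < Real.sqrt l := Real.sqrt_pos.2 (by exact_mod_cast hl1)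
    obtain ⟨m, -, htm⟩ := Set.mem_iUnion₂.1 (hfsupp l hl1 hft).2
    have hd : 0 < 1 / Real.sqrt l := by positivity
    have htU : t ∈ U := Set.mem_iUnion_of_mem m ⟨by linarith [htm.1], by linarith [htm.2]⟩
    have htF : t ∉ frontier U := fun h' => (hUo.frontier_eq ▸ h').2 htU
    have hh₂ : |h₂ t| ≤ C * Real.sqrt l := by
      refine (hC t htF).trans ?_
      rcases (frontier U).eq_empty_or_nonempty with he | hne
      · rw [he, Metric.infDist_empty, div_zero]
        positivity
      · calc C / Metric.infDist t (frontier U) ≤ C / (1 / Real.sqrt l) :=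
            div_le_div_of_nonneg_left hC0.le hd (le_infDist_frontier_iUnion_Ioo htm hne)
          _ = C * Real.sqrt l := by rw [div_div_eq_mul_div, div_one]
    have hmem : t ∈ {t : ℝ | θ ≤ |h₁ t|} := by
      have h3 := abs_add_le (h₁ t) (h₂ t)
      rw [← hsum t htF] at h3
      have h4 : (l : ℝ) ≤ |h t| := ht
      change θ ≤ |h₁ t|
      linarith
    rw [Set.indicator_of_mem hmem]
    exact (hf1 l t).trans (gU t htU)
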